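/- Special case of Carlitz's ${}_5\phi_4$ sum with odd upper index: for any nonnegative integer m and parameters b, c, d, e with b·c·d·e = q^{m+3}, ∑_{k=0}^{2m+1} [(q^{-2m-1};q)_k (bq^{-m-1};q)_k (cq^{-m-1};q)_k (dq^{-m-1};q)_k (eq^{-m-1};q)_k / ((q;q)_k (q^{-m+1}/b;q)_k (q^{-m+1}/c;q)_k (q^{-m+1}/d;q)_k (q^{-m+1}/e;q)_k)] q^k = (q-1) q^{m^2+2m-1} (de)^{-m} (q^{-2m-1};q)_{2m} (q^2/bc;q)_m (q^2/bd;q)_m (q^2/be;q)_m / [(q;q)_m (q^{-m+1}/b;q)_m (q^{-m+1}/d;q)_m (q^{-m+1}/e;q)_m (c;q)_m]. -/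

import Mathlib

open Finset

noncomputable def qp (q a : ℂ) (n : ℕ) : ℂ := ∏ j ∈ Finset.range n, (1 - a * q ^ j)

noncomputable def qpZ (q a : ℂ) (k : ℤ) : ℂ :=
  if 0 ≤ k then qp q a k.toNat else 1 / qp q (a * q ^ k) (-k).toNat

noncomputable def qpInf (q a : ℂ) : ℂ := ∏' j : ℕ, (1 - a * q ^ j)


theorem qp_zero (q a : ℂ) : qp q a 0 = 1 := by simp [qp]

theorem qp_succ (q a : ℂ) (n : ℕ) : qp q a (n + 1) = qp q a n * (1 - a * q ^ n) := by
  simp [qp, Finset.prod_range_succ]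

theorem qp_succ' (q a : ℂ) (n : ℕ) : qp q a (n + 1) = (1 - a) * qp q (a * q) n := by
  simp only [qp, Finset.prod_range_succ', pow_zero, mul_one]
  rw [mul_comm]
  congr 1
  apply Finset.prod_congr rfl
  intro j _
  ring

theorem qp_ne (q a : ℂ) (n : ℕ) (h : qp q a n ≠ 0) (j : ℕ) (hj : j < n) : 1 - a * q ^ j ≠ 0 := by
  rw [qp, Finset.prod_ne_zero_iff] at h
  exact h j (Finset.mem_range.2 hj)

theorem qp_ne_of (q a : ℂ) (n : ℕ) (h : ∀ j < n, 1 - a * q ^ j ≠ 0) : qp q a n ≠ 0 := by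
  rw [qp, Finset.prod_ne_zero_iff]
  intro j hj
  exact h j (Finset.mem_range.1 hj)

/-- ratio of two shifted factorials -/
noncomputable def rr (q X Y : ℂ) (k : ℕ) : ℂ := qp q X k / qp q Y k

theorem rr_zero (q X Y : ℂ) : rr q X Y 0 = 1 := by simp [rr, qp_zero]

theorem rr_nn (q X Y : ℂ) (k : ℕ) :
    rr q X Y (k + 1) = rr q X Y k * ((1 - X * q ^ k) / (1 - Y * q ^ k)) := by
  rw [rr, rr, qp_succ, qp_succ, mul_div_mul_comm]

theorem rr_sn (q X Y : ℂ) (k : ℕ) :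
    rr q X Y (k + 1) = rr q (X * q) Y k * ((1 - X) / (1 - Y * q ^ k)) := by
  rw [rr, rr, qp_succ', qp_succ, mul_comm (1 - X), mul_div_mul_comm]

theorem rr_ns (q X Y : ℂ) (k : ℕ) :
    rr q X Y (k + 1) = rr q X (Y * q) k * ((1 - X * q ^ k) / (1 - Y)) := by
  rw [rr, rr, qp_succ, qp_succ', mul_comm (1 - Y), mul_div_mul_comm]

theorem rr_ss (q X Y : ℂ) (k : ℕ) :
    rr q X Y (k + 1) = rr q (X * q) (Y * q) k * ((1 - X) / (1 - Y)) := by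
  rw [rr, rr, qp_succ', qp_succ', mul_comm (1 - X), mul_comm (1 - Y), mul_div_mul_comm]

/-- very-well-poised term -/
noncomputable def TT (q a b c d z : ℂ) (k : ℕ) : ℂ :=
  (1 - a * (q ^ k) ^ 2) * q ^ k * (rr q a q k * rr q b (a * q / b) k * rr q c (a * q / c) k *
    rr q d (a * q / d) k * rr q (a * z / (b * c * d)) (b * c * d / z * q) k * rr q (a / z * q) z k)

noncomputable def QQ (q a b c d z : ℂ) (k : ℕ) : ℂ :=
  rr q (a * q) q k * rr q (b * q) (a * q / b) k * rr q (c * q) (a * q / c) k *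
    rr q (d * q) (a * q / d) k * rr q (a * z / (b * c * d) * q) (b * c * d / z * q) k *
    rr q (a / z * q) (z * q) k

noncomputable def rho (b c d z : ℂ) : ℂ :=
  (1 - z) * ((b*c-z)*(b*d-z)*(c*d-z)/((b-z)*(c-z)*(d-z)*(b*c*d-z)))

noncomputable def om (b c d z : ℂ) : ℂ :=
  (1-b)*(1-c)*(1-d) * -(z*(b*c*d-z^2)/((b-z)*(c-z)*(d-z)*(b*c*d-z)))

set_option maxHeartbeats 4000000 in
theorem rat_id (a b c d w z : ℂ)
   (h1 : 1 - w ≠ 0) (h2 : b - a*w ≠ 0) (h3 : c - a*w ≠ 0) (h4 : d - a*w ≠ 0)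
   (h5 : z - b*c*d*w ≠ 0) (h6 : z - b*c*d ≠ 0) (h8 : 1 - z*w ≠ 0)
   (h9 : b - z ≠ 0) (h10 : c - z ≠ 0) (h11 : d - z ≠ 0) :
   (1-a*w^2)*w*(b*c*d-a*z*w)*(z-a)/((1-w)*(b-a*w)*(c-a*w)*(d-a*w)*(z-b*c*d)*(1-z*w))
   - (b*c-z)*(b*d-z)*(c*d-z)/((b-z)*(c-z)*(d-z)*(b*c*d-z)) * ((1-a*w^2)*w*(b*c*d-a*z)*(z-a*w)
      /((1-w)*(b-a*w)*(c-a*w)*(d-a*w)*(z-b*c*d*w)))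
   = -(z*(b*c*d-z^2)/((b-z)*(c-z)*(d-z)*(b*c*d-z))) *
     ((1-a*w)*(1-b*w)*(1-c*w)*(1-d*w)*(b*c*d-a*z*w)*(z-a*w)
     /((1-w)*(b-a*w)*(c-a*w)*(d-a*w)*(z-b*c*d*w)*(1-z*w)) - 1) := by
  have e : (b*c*d-z) = -(z - b*c*d) := by ring
  rw [e]
  generalize g1 : 1 - w = D1 at *
  generalize g2 : b - a*w = D2 at *
  generalize g3 : c - a*w = D3 at *
  generalize g4 : d - a*w = D4 at *
  generalize g5 : z - b*c*d*w = D5 at *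
  generalize g6 : z - b*c*d = D6 at *
  generalize g8 : 1 - z*w = D8 at *
  generalize g9 : b - z = D9 at *
  generalize g10 : c - z = D10 at *
  generalize g11 : d - z = D11 at *
  field_simp
  subst g1 g2 g3 g4 g5 g6 g8 g9 g10 g11
  ring

theorem one_sub_rho (b c d z : ℂ) (h6 : z - b*c*d ≠ 0)
   (h9 : b - z ≠ 0) (h10 : c - z ≠ 0) (h11 : d - z ≠ 0) : 1 - rho b c d z = om b c d z := by
  have e : (b*c*d-z) = -(z - b*c*d) := by ring
  rw [rho, om, e]
  generalize g6 : z - b*c*d = D6 at *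
  generalize g9 : b - z = D9 at *
  generalize g10 : c - z = D10 at *
  generalize g11 : d - z = D11 at *
  field_simp
  subst g6 g9 g10 g11
  ring

theorem one_sub_div' (x y : ℂ) (hy : y ≠ 0) : 1 - x / y = (y - x) / y := by
  field_simp

theorem eq_of_mul_one (x y P : ℂ) (h : P = 1) (e : x = y * P) : x = y := by
  rw [e, h, mul_one]

theorem TT_succ (q a b c d z : ℂ) (k : ℕ) (hb : b ≠ 0) (hc : c ≠ 0) (hd : d ≠ 0) (hz : z ≠ 0)
    (h7 : 1 - z ≠ 0) :
    (1 - z) * TT q a b c d z (k + 1) = (1-a)*(1-b)*(1-c)*(1-d) * QQ q a b c d z k *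
      ((1-a*(q^(k+1))^2)*q^(k+1)*(b*c*d-a*z)*(z-a*q^(k+1))
      /((1-q^(k+1))*(b-a*q^(k+1))*(c-a*q^(k+1))*(d-a*q^(k+1))*(z-b*c*d*q^(k+1)))) := by
  rw [TT, QQ, rr_sn q a, rr_sn q b, rr_sn q c, rr_sn q d, rr_sn q (a * z / (b*c*d)), rr_ns q (a / z * q)]
  have e1 : q * q ^ k = q ^ (k+1) := by ring
  have e2 : ∀ y : ℂ, y ≠ 0 → 1 - a * q / y * q ^ k = (y - a * q ^ (k+1)) / y := by
    intro y hy; field_simp; ring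
  have e3 : 1 - b * c * d / z * q * q ^ k = (z - b*c*d * q ^ (k+1)) / z := by
    field_simp; ring
  have e4 : 1 - a / z * q * q ^ k = (z - a * q ^ (k+1)) / z := by
    field_simp; ring
  rw [e1, e2 b hb, e2 c hc, e2 d hd, e3, e4, one_sub_div' _ _ (mul_ne_zero (mul_ne_zero hb hc) hd)]
  generalize q ^ (k+1) = w at *
  generalize 1 - z = D7 at *
  generalize z - b*c*d*w = D5 at *
  generalize b - a*w = D2 at *
  generalize c - a*w = D3 at *
  generalize d - a*w = D4 at *
  generalize 1 - w = D1 at *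
  generalize b*c*d - a*z = D9 at *
  generalize z - a*w = D10 at *
  generalize 1 - a * w ^ 2 = D20
  generalize 1 - a = D21
  generalize 1 - b = D22
  generalize 1 - c = D23
  generalize 1 - d = D24
  generalize rr q (a * q) q k = R1
  generalize rr q (b * q) (a * q / b) k = R2
  generalize rr q (c * q) (a * q / c) k = R3
  generalize rr q (d * q) (a * q / d) k = R4
  generalize rr q (a * z / (b * c * d) * q) (b * c * d / z * q) k = R5
  generalize rr q (a / z * q) (z * q) k = R6
  simp only [div_eq_mul_inv, mul_inv, inv_inv]
  generalize D1⁻¹ = I1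
  generalize D2⁻¹ = I2
  generalize D3⁻¹ = I3
  generalize D4⁻¹ = I4
  generalize D5⁻¹ = I5
  have one : b * b⁻¹ * (c * c⁻¹) * (d * d⁻¹) * (z * z⁻¹) * (D7 * D7⁻¹) = 1 := by
    simp [hb, hc, hd, hz, h7]
  apply eq_of_mul_one _ _ _ one
  ring

theorem TT_succ' (q a b c d z : ℂ) (k : ℕ) (hq : q ≠ 0) (hb : b ≠ 0) (hc : c ≠ 0) (hd : d ≠ 0) (hz : z ≠ 0) :
    TT q a b c d (z * q) (k + 1) = (1-a)*(1-b)*(1-c)*(1-d) * QQ q a b c d z k *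
      ((1-a*(q^(k+1))^2)*q^(k+1)*(b*c*d-a*z*q^(k+1))*(z-a)
      /((1-q^(k+1))*(b-a*q^(k+1))*(c-a*q^(k+1))*(d-a*q^(k+1))*(z-b*c*d)*(1-z*q^(k+1)))) := by
  have f1 : a / (z * q) * q = a / z := by field_simp
  have f2 : b * c * d / (z * q) * q = b * c * d / z := by field_simp
  have f3 : a * (z * q) / (b * c * d) = a * z / (b*c*d) * q := by field_simp
  rw [TT, QQ, f1, f2, f3, rr_sn q a, rr_sn q b, rr_sn q c, rr_sn q d,
    rr_ns q (a * z / (b*c*d) * q), rr_sn q (a / z)]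
  have e1 : q * q ^ k = q ^ (k+1) := by ring
  have e2 : ∀ y : ℂ, y ≠ 0 → 1 - a * q / y * q ^ k = (y - a * q ^ (k+1)) / y := by
    intro y hy; field_simp; ring
  have e3 : 1 - a * z / (b * c * d) * q * q ^ k = (b*c*d - a*z * q ^ (k+1)) / (b*c*d) := by
    field_simp; ring
  have e4 : 1 - z * q * q ^ k = 1 - z * q ^ (k+1) := by ring
  rw [e1, e2 b hb, e2 c hc, e2 d hd, e3, e4, one_sub_div' _ _ hz, one_sub_div' _ _ hz]
  generalize q ^ (k+1) = w at *
  generalize z - b*c*d = D5 at *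
  generalize b - a*w = D2 at *
  generalize c - a*w = D3 at *
  generalize d - a*w = D4 at *
  generalize 1 - w = D1 at *
  generalize 1 - z*w = D6 at *
  generalize b*c*d - a*z*w = D9 at *
  generalize z - a = D10 at *
  generalize 1 - a * w ^ 2 = D20
  generalize 1 - a = D21
  generalize 1 - b = D22
  generalize 1 - c = D23
  generalize 1 - d = D24
  generalize rr q (a * q) q k = R1
  generalize rr q (b * q) (a * q / b) k = R2
  generalize rr q (c * q) (a * q / c) k = R3
  generalize rr q (d * q) (a * q / d) k = R4
  generalize rr q (a * z / (b * c * d) * q) (b * c * d / z * q) k = R5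
  generalize rr q (a / z * q) (z * q) k = R6
  simp only [div_eq_mul_inv, mul_inv, inv_inv]
  generalize D1⁻¹ = I1
  generalize D2⁻¹ = I2
  generalize D3⁻¹ = I3
  generalize D4⁻¹ = I4
  generalize D5⁻¹ = I5
  generalize D6⁻¹ = I6
  have one : b * b⁻¹ * (c * c⁻¹) * (d * d⁻¹) * (z * z⁻¹) = 1 := by
    simp [hb, hc, hd, hz]
  apply eq_of_mul_one _ _ _ one
  ring

theorem QQ_succ (q a b c d z : ℂ) (k : ℕ) (hb : b ≠ 0) (hc : c ≠ 0) (hd : d ≠ 0) (hz : z ≠ 0) :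
    QQ q a b c d z (k + 1) = QQ q a b c d z k *
      ((1-a*q^(k+1))*(1-b*q^(k+1))*(1-c*q^(k+1))*(1-d*q^(k+1))*(b*c*d-a*z*q^(k+1))*(z-a*q^(k+1))
     /((1-q^(k+1))*(b-a*q^(k+1))*(c-a*q^(k+1))*(d-a*q^(k+1))*(z-b*c*d*q^(k+1))*(1-z*q^(k+1)))) := by
  rw [QQ, QQ, rr_nn, rr_nn, rr_nn, rr_nn, rr_nn, rr_nn]
  have e0 : ∀ y : ℂ, 1 - y * q * q ^ k = 1 - y * q ^ (k+1) := by intro y; ring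
  have e1 : q * q ^ k = q ^ (k+1) := by ring
  have e2 : ∀ y : ℂ, y ≠ 0 → 1 - a * q / y * q ^ k = (y - a * q ^ (k+1)) / y := by
    intro y hy; field_simp; ring
  have e3 : 1 - a * z / (b * c * d) * q ^ (k+1) = (b*c*d - a*z * q ^ (k+1)) / (b*c*d) := by
    field_simp
  have e4 : 1 - b * c * d / z * q ^ (k+1) = (z - b*c*d * q ^ (k+1)) / z := by
    field_simp
  have e5 : 1 - a / z * q ^ (k+1) = (z - a * q ^ (k+1)) / z := by
    field_simp
  rw [e2 b hb, e2 c hc, e2 d hd]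
  simp only [e0, e1, e3, e4, e5]
  generalize q ^ (k+1) = w at *
  generalize z - b*c*d*w = D5 at *
  generalize b - a*w = D2 at *
  generalize c - a*w = D3 at *
  generalize d - a*w = D4 at *
  generalize 1 - w = D1 at *
  generalize 1 - z*w = D6 at *
  generalize b*c*d - a*z*w = D9 at *
  generalize z - a*w = D10 at *
  generalize 1 - a * w = D21
  generalize 1 - b * w = D22
  generalize 1 - c * w = D23
  generalize 1 - d * w = D24
  generalize rr q (a * q) q k = R1
  generalize rr q (b * q) (a * q / b) k = R2
  generalize rr q (c * q) (a * q / c) k = R3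
  generalize rr q (d * q) (a * q / d) k = R4
  generalize rr q (a * z / (b * c * d) * q) (b * c * d / z * q) k = R5
  generalize rr q (a / z * q) (z * q) k = R6
  simp only [div_eq_mul_inv, mul_inv, inv_inv]
  generalize D1⁻¹ = I1
  generalize D2⁻¹ = I2
  generalize D3⁻¹ = I3
  generalize D4⁻¹ = I4
  generalize D5⁻¹ = I5
  generalize D6⁻¹ = I6
  have one : b * b⁻¹ * (c * c⁻¹) * (d * d⁻¹) * (z * z⁻¹) = 1 := by
    simp [hb, hc, hd, hz]
  apply eq_of_mul_one _ _ _ one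
  ring

theorem partial_tele (q a b c d z : ℂ) (hq : q ≠ 0) (hb : b ≠ 0) (hc : c ≠ 0) (hd : d ≠ 0)
    (hz : z ≠ 0) (h7 : 1 - z ≠ 0) (h6 : z - b*c*d ≠ 0)
    (h9 : b - z ≠ 0) (h10 : c - z ≠ 0) (h11 : d - z ≠ 0) (K : ℕ)
    (H : ∀ k < K, 1 - q^(k+1) ≠ 0 ∧ b - a*q^(k+1) ≠ 0 ∧ c - a*q^(k+1) ≠ 0 ∧ d - a*q^(k+1) ≠ 0 ∧
      z - b*c*d*q^(k+1) ≠ 0 ∧ 1 - z*q^(k+1) ≠ 0) :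
    ∑ k ∈ Finset.range (K + 1), TT q a b c d (z * q) k
      - rho b c d z * ∑ k ∈ Finset.range (K + 1), TT q a b c d z k
      = om b c d z * (1 - a) * QQ q a b c d z K := by
  induction K with
  | zero =>
    rw [← one_sub_rho b c d z h6 h9 h10 h11]
    simp [TT, QQ, rr_zero]
    ring
  | succ K ih =>
    have ih := ih (fun k hk => H k (by omega))
    obtain ⟨g1, g2, g3, g4, g5, g8⟩ := H K (by omega)
    have key := rat_id a b c d (q^(K+1)) z g1 g2 g3 g4 g5 h6 g8 h9 h10 h11
    have t1 := TT_succ q a b c d z K hb hc hd hz h7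
    have t2 := TT_succ' q a b c d z K hq hb hc hd hz
    have t3 := QQ_succ q a b c d z K hb hc hd hz
    rw [Finset.sum_range_succ, Finset.sum_range_succ _ (K + 1), t2, t3]
    rw [om] at *
    rw [rho] at *
    linear_combination ih + (1-a)*(1-b)*(1-c)*(1-d) * QQ q a b c d z K * key -
      ((b*c-z)*(b*d-z)*(c*d-z)/((b-z)*(c-z)*(d-z)*(b*c*d-z))) * t1

theorem jackson (q a b c d : ℂ) (M : ℕ) (hq : q ≠ 0) (ha : a ≠ 0) (hb : b ≠ 0) (hc : c ≠ 0) (hd : d ≠ 0)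
    (H1 : ∀ j, 1 ≤ j → j ≤ M → 1 - q ^ j ≠ 0)
    (H2 : ∀ j, 1 ≤ j → j ≤ M → b - a * q ^ j ≠ 0)
    (H3 : ∀ j, 1 ≤ j → j ≤ M → c - a * q ^ j ≠ 0)
    (H4 : ∀ j, 1 ≤ j → j ≤ M → d - a * q ^ j ≠ 0)
    (H5 : ∀ j, j ≤ M → a * q ^ j - b * c * d ≠ 0)
    (H6 : ∀ j, j ≤ 2 * M → 1 - a * q ^ j ≠ 0) (N : ℕ) (hN : N ≤ M) :
    ∑ k ∈ Finset.range (N + 1), TT q a b c d (a * q ^ (N + 1)) k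
      = (1 - a) * ∏ j ∈ Finset.range N, rho b c d (a * q ^ (j + 1)) := by
  induction N with
  | zero => simp [TT, rr_zero]
  | succ N ih =>
    have ih := ih (by omega)
    have hz : a * q ^ (N+1) ≠ 0 := mul_ne_zero ha (pow_ne_zero _ hq)
    have P := partial_tele q a b c d (a * q ^ (N+1)) hq hb hc hd hz (H6 _ (by omega)) (H5 _ hN)
      (H2 _ (by omega) hN) (H3 _ (by omega) hN) (H4 _ (by omega) hN) (N + 1) (by
        intro k hk
        refine ⟨H1 _ (by omega) (by omega), H2 _ (by omega) (by omega), H3 _ (by omega) (by omega),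
          H4 _ (by omega) (by omega), ?_, ?_⟩
        · have := H5 (N - k) (by omega)
          have e : a * q ^ (N+1) - b*c*d*q^(k+1) = (a * q ^ (N-k) - b*c*d) * q^(k+1) := by
            have : N + 1 = (N - k) + (k+1) := by omega
            conv_lhs => rw [this]
            ring
          rw [e]
          exact mul_ne_zero this (pow_ne_zero _ hq)
        · have := H6 (N + 1 + (k+1)) (by omega)
          rwa [pow_add, ← mul_assoc] at this)
    have hv : qp q (a / (a * q ^ (N+1)) * q) (N + 1) = 0 := by
      rw [qp_succ]
      have : a / (a * q ^ (N+1)) * q * q ^ N = 1 := by field_simp; ring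
      rw [this]; simp
    have hr : ∀ Y, rr q (a / (a * q ^ (N+1)) * q) Y (N + 1) = 0 := by
      intro Y; rw [rr, hv, zero_div]
    have hQ : QQ q a b c d (a * q ^ (N+1)) (N + 1) = 0 := by
      rw [QQ, hr, mul_zero]
    have hT : TT q a b c d (a * q ^ (N+1)) (N + 1) = 0 := by
      rw [TT, hr, mul_zero, mul_zero]
    rw [hQ, Finset.sum_range_succ (fun k => TT q a b c d (a * q ^ (N+1)) k), hT, ih] at P
    rw [Finset.prod_range_succ, pow_succ q (N+1), ← mul_assoc a]
    linear_combination P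

/-- reflection of well-poised ratios -/
theorem reflect (q X A : ℂ) (m : ℕ) (hXA : X * A * q ^ (2 * m) = 1)
    (hA : qp q A (2 * m + 1) ≠ 0) (r k : ℕ) (hk : k + r = m) :
    rr q X A (k + (2 * r + 1)) = (-(X * q ^ m)) ^ (2 * r + 1) * rr q X A k := by
  induction r generalizing k with
  | zero =>
    have hk : k = m := by omega
    subst hk
    have h := qp_ne q A _ hA k (by omega)
    rw [show k + (2 * 0 + 1) = k + 1 by ring, rr_nn]
    have : (1 - X * q ^ k) / (1 - A * q ^ k) = -(X * q ^ k) := by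
      rw [div_eq_iff h]
      linear_combination -hXA
    rw [this]; ring
  | succ r ih =>
    have ih := ih (k+1) (by omega)
    have g1 := qp_ne q A _ hA k (by omega)
    have g2 := qp_ne q A _ hA (k + 2 * r + 2) (by omega)
    have e0 : q ^ (2 * m) = q ^ k * q ^ (k + 2 * r + 2) := by
      rw [← pow_add]; congr 1; omega
    have e0' : q ^ (2 * m) = q ^ m * q ^ m := by
      rw [← pow_add]; congr 1; omega
    rw [show k + (2 * (r+1) + 1) = (k + 2 * r + 2) + 1 by ring, rr_nn,
      show k + 2 * r + 2 = k + 1 + (2 * r + 1) by ring, ih, rr_nn,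
      show k + 1 + (2 * r + 1) = k + 2 * r + 2 by ring]
    have f1 : (1 - X * q ^ k) / (1 - A * q ^ (k + 2 * r + 2)) = -(X * q ^ k) := by
      rw [div_eq_iff g2]
      linear_combination -hXA + X * A * e0
    have f2 : (1 - X * q ^ (k + 2 * r + 2)) / (1 - A * q ^ k) = -(X * q ^ (k + 2 * r + 2)) := by
      rw [div_eq_iff g1]
      linear_combination -hXA + X * A * e0
    have f3 : (1 - X * q ^ k) / (1 - A * q ^ k) *
        ((1 - X * q ^ (k + 2 * r + 2)) / (1 - A * q ^ (k + 2 * r + 2))) = X ^ 2 * q ^ (2 * m) := by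
      rw [div_mul_div_comm, mul_comm (1 - A * q ^ k), ← div_mul_div_comm, f1, f2, e0]; ring
    rw [e0'] at f3
    linear_combination (-(X * q ^ m)) ^ (2 * r + 1) * rr q X A k * f3

theorem qp_rev (q Y Z : ℂ) (m : ℕ) (h : Y * Z * q ^ m = q) (hq : q ≠ 0) :
    qp q Y m = (-Y) ^ m * q ^ (∑ i ∈ Finset.range m, i) * qp q Z m := by
  have : qp q Z m = ∏ j ∈ Finset.range m, (1 - Z * q ^ (m - 1 - j)) := by
    rw [qp, ← Finset.prod_range_reflect]
  rw [this, ← Finset.prod_pow_eq_pow_sum]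
  have h2 : (-Y) ^ m = ∏ j ∈ Finset.range m, (-Y) := by simp
  rw [h2, ← Finset.prod_mul_distrib, ← Finset.prod_mul_distrib, qp]
  apply Finset.prod_congr rfl
  intro j hj
  have hj := Finset.mem_range.1 hj
  have e : q ^ m = q * (q ^ j * q ^ (m - 1 - j)) := by
    rw [← pow_add, ← pow_succ']; congr 1; omega
  rw [e] at h
  have : Y * Z * (q ^ j * q ^ (m - 1 - j)) = 1 := by
    apply mul_left_cancel₀ hq
    linear_combination h
  linear_combination -this

theorem qp_rev2 (q Y Z Y' Z' : ℂ) (m : ℕ) (h : Y * Z * q ^ m = q) (h' : Y' * Z' * q ^ m = q)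
    (hq : q ≠ 0) :
    qp q Y m * qp q Y' m * q ^ m = (Y * Y') ^ m * q ^ (m ^ 2) * (qp q Z m * qp q Z' m) := by
  rw [qp_rev q Y Z m h hq, qp_rev q Y' Z' m h' hq]
  have e : q ^ (m ^ 2) = q ^ (∑ i ∈ Finset.range m, i) * q ^ (∑ i ∈ Finset.range m, i) * q ^ m := by
    rw [← pow_add, ← pow_add]
    congr 1
    have := Finset.sum_range_id_mul_two m
    rcases m with _ | m
    · simp
    · simp only [Nat.add_sub_cancel] at this
      nlinarith
  rw [e, mul_pow, neg_pow, neg_pow Y']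
  have s : ((-1 : ℂ) ^ m) * (-1) ^ m = 1 := by rw [← mul_pow]; simp
  linear_combination (Y ^ m * Y' ^ m * q ^ (∑ i ∈ Finset.range m, i) * q ^ (∑ i ∈ Finset.range m, i)
    * q ^ m * qp q Z m * qp q Z' m) * s

noncomputable def tt (q a B C D E : ℂ) (k : ℕ) : ℂ :=
  q ^ k * (rr q a q k * rr q B (a * q / B) k * rr q C (a * q / C) k * rr q D (a * q / D) k *
    rr q E (a * q / E) k)

theorem core (q a B C D E : ℂ) (m : ℕ) (hq : q ≠ 0) (ha : a * q ^ (2 * m + 1) = 1)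
    (hB : B ≠ 0) (hC : C ≠ 0) (hD : D ≠ 0) (hE : E ≠ 0)
    (hP : B * C * D * E = a * (a * q ^ (m + 1)))
    (h1 : qp q q (2 * m + 1) ≠ 0)
    (h2 : qp q (a * q / B) (2 * m + 1) ≠ 0)
    (h3 : qp q (a * q / C) (2 * m + 1) ≠ 0)
    (h4 : qp q (a * q / D) (2 * m + 1) ≠ 0)
    (h5 : qp q (a * q / E) (2 * m + 1) ≠ 0) :
    ∑ k ∈ Finset.range (2 * m + 2), tt q a B C D E k =
      (1 - a) * ∏ j ∈ Finset.range m, rho B D E (a * q ^ (j + 1)) := by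
  have ha0 : a ≠ 0 := by
    rintro rfl
    simp at ha
  have K1 : ∀ j, 1 ≤ j → j ≤ 2 * m + 1 → 1 - q ^ j ≠ 0 := by
    intro j hj hj'
    have := qp_ne q q _ h1 (j - 1) (by omega)
    rwa [← pow_succ', Nat.sub_add_cancel hj] at this
  have K2 : ∀ X, X ≠ 0 → qp q (a * q / X) (2 * m + 1) ≠ 0 →
      ∀ j, 1 ≤ j → j ≤ m → X - a * q ^ j ≠ 0 := by
    intro X hX h j hj hj'
    have := qp_ne q _ _ h (j - 1) (by omega)
    obtain ⟨i, rfl⟩ : ∃ i, j = i + 1 := ⟨j - 1, by omega⟩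
    simp only [Nat.add_sub_cancel] at this
    intro h0
    apply this
    field_simp
    linear_combination h0
  have K6 : ∀ j, j ≤ 2 * m → 1 - a * q ^ j ≠ 0 := by
    intro j hj h0
    have := K1 (2 * m + 1 - j) (by omega) (by omega)
    apply this
    have e : q ^ (2 * m + 1) = q ^ j * q ^ (2 * m + 1 - j) := by
      rw [← pow_add]; congr 1; omega
    rw [e] at ha
    linear_combination -ha - q ^ (2 * m + 1 - j) * h0 + 0 * hP
  have K5 : ∀ j, j ≤ m → a * q ^ j - B * D * E ≠ 0 := by
    intro j hj h0
    have := qp_ne q _ _ h3 (m - j) (by omega)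
    apply this
    have e : q ^ (m + 1) = q ^ j * (q * q ^ (m - j)) := by
      rw [← pow_succ', ← pow_add]; congr 1; omega
    rw [e] at hP
    have hx : a * q ^ j ≠ 0 := mul_ne_zero ha0 (pow_ne_zero _ hq)
    have h00 : C - a * q * q ^ (m - j) = 0 := by
      apply mul_left_cancel₀ hx
      linear_combination C * h0 + hP
    field_simp
    linear_combination h00
  have J := jackson q a B D E m hq ha0 hB hD hE (fun j h h' => K1 j h (by omega)) (K2 B hB h2)
    (K2 D hD h4) (K2 E hE h5) K5 K6 m le_rfl
  rw [← J]
  have hsplit : ∑ k ∈ Finset.range (2 * m + 2), tt q a B C D E k =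
      ∑ k ∈ Finset.range (m + 1), (tt q a B C D E k + tt q a B C D E (k + (2 * (m - k) + 1))) := by
    rw [show 2 * m + 2 = (m + 1) + (m + 1) by ring, Finset.sum_range_add, Finset.sum_add_distrib]
    congr 1
    rw [← Finset.sum_range_reflect]
    apply Finset.sum_congr rfl
    intro k hk
    have hk := Finset.mem_range.1 hk
    congr 1
    omega
  rw [hsplit]
  apply Finset.sum_congr rfl
  intro k hk
  have hk := Finset.mem_range.1 hk
  obtain ⟨r, hr⟩ : ∃ r, k + r = m := ⟨m - k, by omega⟩
  have hr' : m - k = r := by omega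
  rw [hr']
  have XA : ∀ X, X ≠ 0 → X * (a * q / X) * q ^ (2 * m) = 1 := by
    intro X hX
    rw [mul_div_cancel₀ _ hX, ← ha]; ring
  have R1 := reflect q a q m (by rw [← ha]; ring) h1 r k hr
  have R2 := reflect q B _ m (XA B hB) h2 r k hr
  have R3 := reflect q C _ m (XA C hC) h3 r k hr
  have R4 := reflect q D _ m (XA D hD) h4 r k hr
  have R5 := reflect q E _ m (XA E hE) h5 r k hr
  have sgn : q * (-(a * q ^ m)) * (-(B * q ^ m)) * (-(C * q ^ m)) * (-(D * q ^ m)) * (-(E * q ^ m))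
      = -q⁻¹ := by
    have ha' : a * (q ^ m) ^ 2 * q = 1 := by rw [← ha]; ring
    have hP' : B * C * D * E = a * (a * (q ^ m * q)) := by rw [hP]; ring
    generalize q ^ m = p at *
    field_simp
    have h3 : (a * p ^ 2 * q) ^ 3 = 1 := by rw [ha']; simp
    linear_combination -q^2 * a * p^5 * hP' - h3
  have sgn2 : (-q⁻¹) ^ (2 * r + 1) = - (a * (q ^ k) ^ 2) := by
    rw [Odd.neg_pow ⟨r, rfl⟩, inv_pow]
    congr 1
    apply inv_eq_of_mul_eq_one_right
    rw [← ha, ← hr]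
    ring
  have t2 : tt q a B C D E (k + (2 * r + 1)) = - (a * (q ^ k) ^ 2) * tt q a B C D E k := by
    rw [tt, R1, R2, R3, R4, R5, ← sgn2, ← sgn, tt, pow_add]
    simp only [mul_pow]
    ring
  rw [t2]
  have u1 : a * (a * q ^ (m + 1)) / (B * D * E) = C := by
    rw [← hP]; field_simp
  have u2 : B * D * E / (a * q ^ (m + 1)) * q = a * q / C := by
    have : a * q ^ (m + 1) ≠ 0 := mul_ne_zero ha0 (pow_ne_zero _ hq)
    rw [div_mul_eq_mul_div, div_eq_div_iff this hC]
    linear_combination q * hP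
  have u3 : a / (a * q ^ (m + 1)) * q = a * q ^ (m + 1) := by
    rw [div_mul_eq_mul_div, div_eq_iff (mul_ne_zero ha0 (pow_ne_zero _ hq))]
    have : a * (a * q ^ (2 * m + 1)) * q = a * q := by rw [ha]; ring
    rw [← this]; ring
  have u4 : rr q (a * q ^ (m + 1)) (a * q ^ (m + 1)) k = 1 := by
    rw [rr]
    apply div_self
    apply qp_ne_of
    intro j hj
    rw [mul_assoc, ← pow_add]
    exact K6 _ (by omega)
  rw [TT, u1, u2, u3, u4, tt]
  ring

theorem prod_rho (q a b c d : ℂ) (m : ℕ) (hb : b ≠ 0) (hc : c ≠ 0) (hd : d ≠ 0) :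
    ∏ j ∈ Finset.range m, rho b c d (a * q ^ (j + 1)) =
    qp q (a * q) m * qp q (a * q / (b * c)) m * qp q (a * q / (b * d)) m * qp q (a * q / (c * d)) m /
    (qp q (a * q / b) m * qp q (a * q / c) m * qp q (a * q / d) m * qp q (a * q / (b * c * d)) m) := by
  simp only [qp]
  rw [← Finset.prod_mul_distrib, ← Finset.prod_mul_distrib, ← Finset.prod_mul_distrib,
    ← Finset.prod_mul_distrib, ← Finset.prod_mul_distrib, ← Finset.prod_mul_distrib,
    ← Finset.prod_div_distrib]
  apply Finset.prod_congr rfl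
  intro j _
  have e : ∀ y : ℂ, y ≠ 0 → 1 - a * q / y * q ^ j = (y - a * q ^ (j+1)) / y := by
    intro y hy; field_simp; ring
  rw [e _ hb, e _ hc, e _ hd, e _ (mul_ne_zero hb hc), e _ (mul_ne_zero hb hd),
    e _ (mul_ne_zero hc hd), e _ (mul_ne_zero (mul_ne_zero hb hc) hd), rho,
    show a * q * q ^ j = a * q ^ (j + 1) by ring]
  generalize a * q ^ (j + 1) = z
  generalize b * c * d - z = D0
  generalize b * c - z = D1
  generalize b * d - z = D2
  generalize c * d - z = D3
  generalize b - z = D4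
  generalize c - z = D5
  generalize d - z = D6
  simp only [div_eq_mul_inv, mul_inv, inv_inv]
  have one : b * b⁻¹ * (c * c⁻¹) * (d * d⁻¹) = 1 := by simp [hb, hc, hd]
  have one2 : (b * b⁻¹ * (c * c⁻¹) * (d * d⁻¹)) ^ 2 = 1 := by rw [one]; simp
  symm
  apply eq_of_mul_one _ _ _ one2
  ring

theorem stmt12 (q b c d e : ℂ) (m : ℕ) (hq : q ≠ 0)
    (hbcde : b * c * d * e = q ^ (m + 3))
    (h1 : qp q q (2 * m + 1) ≠ 0)
    (h2 : qp q (q ^ (1 - (m : ℤ)) / b) (2 * m + 1) ≠ 0)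
    (h3 : qp q (q ^ (1 - (m : ℤ)) / c) (2 * m + 1) ≠ 0)
    (h4 : qp q (q ^ (1 - (m : ℤ)) / d) (2 * m + 1) ≠ 0)
    (h5 : qp q (q ^ (1 - (m : ℤ)) / e) (2 * m + 1) ≠ 0)
    (h6 : qp q c m ≠ 0) :
    (∑ k ∈ Finset.range (2 * m + 2),
        (qp q (q ^ (-(2 * (m : ℤ)) - 1)) k * qp q (b * q ^ (-(m : ℤ) - 1)) k *
            qp q (c * q ^ (-(m : ℤ) - 1)) k * qp q (d * q ^ (-(m : ℤ) - 1)) k *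
            qp q (e * q ^ (-(m : ℤ) - 1)) k) /
          (qp q q k * qp q (q ^ (1 - (m : ℤ)) / b) k * qp q (q ^ (1 - (m : ℤ)) / c) k *
            qp q (q ^ (1 - (m : ℤ)) / d) k * qp q (q ^ (1 - (m : ℤ)) / e) k) * q ^ k) =
      (q - 1) * q ^ ((m : ℤ) ^ 2 + 2 * m - 1) * (d * e) ^ (-(m : ℤ)) *
        (qp q (q ^ (-(2 * (m : ℤ)) - 1)) (2 * m) * qp q (q ^ 2 / (b * c)) m *
          qp q (q ^ 2 / (b * d)) m * qp q (q ^ 2 / (b * e)) m) /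
        (qp q q m * qp q (q ^ (1 - (m : ℤ)) / b) m * qp q (q ^ (1 - (m : ℤ)) / d) m *
          qp q (q ^ (1 - (m : ℤ)) / e) m * qp q c m) := by
  have hn : b * c * d * e ≠ 0 := by rw [hbcde]; exact pow_ne_zero _ hq
  have he : e ≠ 0 := right_ne_zero_of_mul hn
  have hd : d ≠ 0 := right_ne_zero_of_mul (left_ne_zero_of_mul hn)
  have hc : c ≠ 0 := right_ne_zero_of_mul (left_ne_zero_of_mul (left_ne_zero_of_mul hn))
  have hb : b ≠ 0 := left_ne_zero_of_mul (left_ne_zero_of_mul (left_ne_zero_of_mul hn))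
  have hp : q ^ m ≠ 0 := pow_ne_zero _ hq
  have z1 : q ^ (-(2 * (m : ℤ)) - 1) = ((q ^ m) ^ 2 * q)⁻¹ := by
    rw [show -(2 * (m : ℤ)) - 1 = -((2 * m + 1 : ℕ) : ℤ) by push_cast; ring, zpow_neg, zpow_natCast]
    congr 1; ring
  have z2 : q ^ (-(m : ℤ) - 1) = (q ^ m * q)⁻¹ := by
    rw [show -(m : ℤ) - 1 = -((m + 1 : ℕ) : ℤ) by push_cast; ring, zpow_neg, zpow_natCast]
    congr 1
  have z3 : q ^ (1 - (m : ℤ)) = q / q ^ m := by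
    rw [zpow_sub₀ hq, zpow_one, zpow_natCast]
  have z4 : q ^ ((m : ℤ) ^ 2 + 2 * m - 1) = q ^ (m ^ 2) * (q ^ m) ^ 2 / q := by
    rw [show (m : ℤ) ^ 2 + 2 * m - 1 = ((m ^ 2 + 2 * m : ℕ) : ℤ) - 1 by push_cast; ring,
      zpow_sub₀ hq, zpow_one, zpow_natCast]
    congr 1; ring
  have z5 : (d * e) ^ (-(m : ℤ)) = ((d * e) ^ m)⁻¹ := by
    rw [zpow_neg, zpow_natCast]
  have hbcde' : b * c * d * e = q ^ m * q ^ 3 := by rw [hbcde]; ring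
  obtain ⟨a, ha⟩ : ∃ a, a = ((q ^ m) ^ 2 * q)⁻¹ := ⟨_, rfl⟩
  have haq : a * ((q ^ m) ^ 2 * q) = 1 := by
    rw [ha]; apply inv_mul_cancel₀; exact mul_ne_zero (pow_ne_zero _ hp) hq
  have w : ∀ x : ℂ, x ≠ 0 → q / q ^ m / x = a * q / (x * (q ^ m * q)⁻¹) := by
    intro x hx
    rw [ha]
    field_simp
  rw [z3, w b hb] at h2
  rw [z3, w c hc] at h3
  rw [z3, w d hd] at h4
  rw [z3, w e he] at h5
  rw [z1, z2, z3, z4, z5, w b hb, w c hc, w d hd, w e he, ← ha]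
  have hi : (q ^ m * q)⁻¹ ≠ 0 := inv_ne_zero (mul_ne_zero hp hq)
  have C := core q a (b * (q ^ m * q)⁻¹) (c * (q ^ m * q)⁻¹) (d * (q ^ m * q)⁻¹)
    (e * (q ^ m * q)⁻¹) m hq (by rw [← haq]; ring) (mul_ne_zero hb hi) (mul_ne_zero hc hi)
    (mul_ne_zero hd hi) (mul_ne_zero he hi) (by
      rw [pow_succ, ha]
      generalize q ^ m = p at *
      have : b * (p * q)⁻¹ * (c * (p * q)⁻¹) * (d * (p * q)⁻¹) * (e * (p * q)⁻¹)
        = (b * c * d * e) * ((p * q)⁻¹) ^ 4 := by ring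
      rw [this, hbcde']
      field_simp) h1 h2 h3 h4 h5
  have L : ∀ k, (qp q a k * qp q (b * (q ^ m * q)⁻¹) k *
            qp q (c * (q ^ m * q)⁻¹) k * qp q (d * (q ^ m * q)⁻¹) k *
            qp q (e * (q ^ m * q)⁻¹) k) /
          (qp q q k * qp q (a * q / (b * (q ^ m * q)⁻¹)) k * qp q (a * q / (c * (q ^ m * q)⁻¹)) k *
            qp q (a * q / (d * (q ^ m * q)⁻¹)) k * qp q (a * q / (e * (q ^ m * q)⁻¹)) k) * q ^ k =
        tt q a (b * (q ^ m * q)⁻¹) (c * (q ^ m * q)⁻¹) (d * (q ^ m * q)⁻¹)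
          (e * (q ^ m * q)⁻¹) k := by
    intro k
    simp only [tt, rr, div_mul_div_comm]
    rw [mul_comm]
  rw [Finset.sum_congr rfl (fun k _ => L k), C,
    prod_rho q a _ _ _ m (mul_ne_zero hb hi) (mul_ne_zero hd hi) (mul_ne_zero he hi)]
  have v1 : ∀ x y : ℂ, x ≠ 0 → y ≠ 0 →
      a * q / (x * (q ^ m * q)⁻¹ * (y * (q ^ m * q)⁻¹)) = q ^ 2 / (x * y) := by
    intro x y hx hy
    rw [ha]
    field_simp
  have v2 : a * q / (b * (q ^ m * q)⁻¹ * (d * (q ^ m * q)⁻¹) * (e * (q ^ m * q)⁻¹)) = c := by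
    rw [ha]
    generalize q ^ m = p at *
    field_simp
    linear_combination -hbcde'
  rw [v1 b d hb hd, v1 b e hb he, v1 d e hd he, v2]
  have A1 : (1 - a) * qp q (a * q) m * qp q (a * q ^ (m + 1)) m = qp q a (2 * m) * ((q - 1) / q) := by
    have s1 : qp q a (2 * m + 1) = qp q a (2 * m) * ((q - 1) / q) := by
      rw [qp_succ]
      congr 1
      rw [eq_div_iff hq]
      linear_combination -haq
    rw [← s1, ← qp_succ']
    simp only [qp]
    rw [show 2 * m + 1 = (m + 1) + m by ring, Finset.prod_range_add _ (m + 1) m]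
    congr 1
    apply Finset.prod_congr rfl
    intro j _
    ring
  have A2 := qp_rev2 q q (a * q ^ (m + 1)) (q ^ 2 / (d * e)) (q ^ 2 / (b * c)) m
    (by linear_combination q * haq) (by
      field_simp
      linear_combination -hbcde') hq
  have hqm : qp q q m ≠ 0 := by
    apply qp_ne_of
    intro j hj
    exact qp_ne q q _ h1 j (by omega)
  have A3 : qp q q m * ((1 - a) * qp q (a * q) m * qp q (q ^ 2 / (d * e)) m) =
      (q - 1) * (q ^ (m ^ 2) * (q ^ m) ^ 2 / q) * ((d * e) ^ m)⁻¹ *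
        (qp q a (2 * m) * qp q (q ^ 2 / (b * c)) m) := by
    have hde : (d * e) ^ m ≠ 0 := pow_ne_zero _ (mul_ne_zero hd he)
    have e1 : (q * (q ^ 2 / (d * e))) ^ m = (q ^ m) ^ 3 * ((d * e) ^ m)⁻¹ := by
      rw [mul_pow, div_pow, ← pow_mul, ← pow_mul, mul_comm 2 m, mul_comm m 3, div_eq_mul_inv]
      ring
    rw [e1] at A2
    apply mul_right_cancel₀ hp
    linear_combination (1 - a) * qp q (a * q) m * A2 +
      (q ^ m) ^ 3 * ((d * e) ^ m)⁻¹ * q ^ (m ^ 2) * qp q (q ^ 2 / (b * c)) m * A1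
  have A4 : (1 - a) * qp q (a * q) m * qp q (q ^ 2 / (d * e)) m =
      (q - 1) * (q ^ (m ^ 2) * (q ^ m) ^ 2 / q) * ((d * e) ^ m)⁻¹ *
        (qp q a (2 * m) * qp q (q ^ 2 / (b * c)) m) * (qp q q m)⁻¹ := by
    rw [← A3]
    field_simp
  simp only [div_eq_mul_inv, mul_inv] at A4 ⊢
  linear_combination (qp q (q ^ 2 * (b⁻¹ * d⁻¹)) m * qp q (q ^ 2 * (b⁻¹ * e⁻¹)) m *
    (qp q (a * q * (b⁻¹ * ((q ^ m)⁻¹⁻¹ * q⁻¹⁻¹))) m)⁻¹ *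
    (qp q (a * q * (d⁻¹ * ((q ^ m)⁻¹⁻¹ * q⁻¹⁻¹))) m)⁻¹ *
    (qp q (a * q * (e⁻¹ * ((q ^ m)⁻¹⁻¹ * q⁻¹⁻¹))) m)⁻¹ * (qp q c m)⁻¹) * A4
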